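/- The measure μ is mixing: for all f, g ∈ L²(μ), lim_{n→∞} ∫ (f∘Tⁿ)·g dμ = (∫ f dμ)·(∫ g dμ). -/

import Mathlib

open MeasureTheory Real

def MixCone (a : ℝ) (h : ℝ → ℝ) : Prop :=
  Continuous h ∧ Function.Periodic h 1 ∧ (∀ x, 0 ≤ h x) ∧
    ∀ x y, h x ≤ exp (a * |x - y|) * h y

theorem mix_transfer
    (F : ℝ → ℝ) (hF : ContDiff ℝ 2 F)
    (w : ℕ) (hFw : ∀ x : ℝ, F (x + 1) = F x + w)
    (lam : ℝ) (hlam : 1 < lam) (hexp : ∀ x : ℝ, lam ≤ deriv F x) :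
    ∃ a a' : ℝ, 0 ≤ a' ∧ a' < a ∧ ∀ h, MixCone a h → ∃ h', MixCone a' h' ∧
      ∀ f : ℝ → ℝ, Continuous f → Function.Periodic f 1 →
        ∫ x in (0:ℝ)..1, f (F x) * h x = ∫ x in (0:ℝ)..1, f x * h' x := by
  have hFc : Continuous F := hF.continuous
  have hFd : Differentiable ℝ F := hF.differentiable (by norm_num)
  have hF1 : ContDiff ℝ 1 (deriv F) := by
    have : ContDiff ℝ (1 + 1) F := by convert hF using 1; norm_num
    exact (contDiff_succ_iff_deriv.1 this).2.2
  have hF1d : Differentiable ℝ (deriv F) := hF1.differentiable (by norm_num)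
  have hF2c : Continuous (deriv (deriv F)) := hF1.continuous_deriv (by norm_num)
  have hp1 : Function.Periodic (deriv F) 1 := by
    intro x
    have : (fun x => F (x + 1)) = fun x => F x + w := funext hFw
    have h2 := congrArg (fun g => deriv g x) this
    simpa [deriv_comp_add_const] using h2
  have hp2 : Function.Periodic (deriv (deriv F)) 1 := by
    intro x
    have : (fun x => deriv F (x + 1)) = fun x => deriv F x := funext hp1
    have h2 := congrArg (fun g => deriv g x) this
    simpa [deriv_comp_add_const] using h2
  obtain ⟨M, hM⟩ : ∃ M, ∀ x, |deriv (deriv F) x| ≤ M := by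
    have := hp2.isBounded_of_continuous one_ne_zero hF2c
    obtain ⟨M, hM⟩ := this.exists_norm_le
    exact ⟨M, fun x => hM _ ⟨x, rfl⟩⟩
  have hM0 : 0 ≤ M := (abs_nonneg _).trans (hM 0)
  have hlip : ∀ u v, deriv F u ≤ deriv F v + M * |u - v| := by
    intro u v
    have := Convex.norm_image_sub_le_of_norm_deriv_le (f := deriv F) (s := Set.univ)
      (C := M) (x := v) (y := u) (fun x _ => hF1d x) (fun x _ => hM x) convex_univ trivial trivial
    rw [norm_eq_abs, norm_eq_abs] at this
    linarith [le_abs_self (deriv F u - deriv F v)]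
  have hexpd : ∀ u v, lam * |u - v| ≤ |F u - F v| := by
    have key : ∀ u v, v ≤ u → lam * (u - v) ≤ F u - F v := by
      intro u v huv
      exact mul_sub_le_image_sub_of_le_deriv hFd hexp huv
    intro u v
    rcases le_total v u with h | h
    · rw [abs_of_nonneg (sub_nonneg.2 h)]
      exact (key u v h).trans (le_abs_self _)
    · rw [abs_sub_comm, abs_of_nonneg (sub_nonneg.2 h), abs_sub_comm]
      exact (key v u h).trans (le_abs_self _)
  have hinj : Function.Injective F := by
    intro u v huv
    have := hexpd u v
    rw [huv, sub_self, abs_zero] at this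
    have h3 : |u - v| ≤ 0 := by nlinarith [abs_nonneg (u - v)]
    exact sub_eq_zero.1 (abs_nonpos_iff.1 h3)
  have hsurj : Function.Surjective F := by
    have key : ∀ u v, v ≤ u → lam * (u - v) ≤ F u - F v := by
      intro u v huv
      exact mul_sub_le_image_sub_of_le_deriv hFd hexp huv
    intro y
    have := intermediate_value_Icc (f := F) (a := -|y - F 0|) (b := |y - F 0|)
      (by linarith [abs_nonneg (y - F 0)]) hFc.continuousOn
    have h1 := key 0 (-|y - F 0|) (by linarith [abs_nonneg (y - F 0)])
    have h2 := key (|y - F 0|) 0 (by linarith [abs_nonneg (y - F 0)])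
    have h3 := abs_le.1 (le_refl |y - F 0|)
    have h4 := abs_nonneg (y - F 0)
    obtain ⟨x, -, hx⟩ := this ⟨(by nlinarith : _ ≤ y), by nlinarith⟩
    exact ⟨x, hx⟩
  choose G hG using hsurj
  have hGF : ∀ x, G (F x) = x := fun x => hinj (hG _)
  have hGl : ∀ x y, lam * |G x - G y| ≤ |x - y| := by
    intro x y
    simpa [hG] using hexpd (G x) (G y)
  have hGc : Continuous G := by
    apply LipschitzWith.continuous (K := 1)
    apply LipschitzWith.of_dist_le_mul
    intro x y
    rw [Real.dist_eq, Real.dist_eq, NNReal.coe_one]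
    nlinarith [hGl x y, abs_nonneg (G x - G y)]
  have hGw : ∀ y, G (y + w) = G y + 1 := by
    intro y
    apply hinj
    rw [hG, hFw, hG]
  have hl1 : 0 < lam - 1 := by linarith
  have hl0 : 0 < lam := by linarith
  have hdp : ∀ x, 0 < deriv F x := fun x => by linarith [hexp x]
  refine ⟨(M + 1) / (lam - 1), ((M + 1) / (lam - 1) + M) / lam, by positivity, ?_, ?_⟩
  · rw [div_lt_iff₀ hl0]
    have : (M + 1) / (lam - 1) * (lam - 1) = M + 1 := by field_simp
    nlinarith
  set a := (M + 1) / (lam - 1) with ha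
  have ha0 : 0 < a := by positivity
  rintro h ⟨hc, hper, hnn, hlog⟩
  set q : ℝ → ℝ := fun y => h (G y) / deriv F (G y) with hq
  have hqc : Continuous q := by
    apply (hc.comp hGc).div (hF1.continuous.comp hGc)
    intro x; exact (hdp _).ne'
  have hqw : ∀ y, q (y + w) = q y := by
    intro y
    simp only [hq, hGw]
    rw [hper, hp1]
  have hqlog : ∀ x y, q x ≤ exp ((a + M) / lam * |x - y|) * q y := by
    intro x y
    have h1 := hlog (G x) (G y)
    have h2 : deriv F (G y) ≤ exp (M * |G x - G y|) * deriv F (G x) := by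
      have e1 := hlip (G y) (G x)
      rw [abs_sub_comm] at e1
      have e2 := add_one_le_exp (M * |G x - G y|)
      have e3 : 1 ≤ deriv F (G x) := by linarith [hexp (G x)]
      have e4 : 0 ≤ M * |G x - G y| := by positivity
      nlinarith
    have h3 : exp (a * |G x - G y|) * exp (M * |G x - G y|) ≤ exp ((a + M) / lam * |x - y|) := by
      rw [← exp_add]
      apply exp_le_exp.2
      have : |G x - G y| ≤ |x - y| / lam := by
        rw [le_div_iff₀ hl0]; linarith [hGl x y]
      calc _ = (a + M) * |G x - G y| := by ring
        _ ≤ (a + M) * (|x - y| / lam) := by gcongr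
        _ = _ := by ring
    simp only [hq]
    rw [div_le_iff₀ (hdp _)]
    have e5 : h (G y) ≤ h (G y) / deriv F (G y) * (exp (M * |G x - G y|) * deriv F (G x)) := by
      calc h (G y) = h (G y) / deriv F (G y) * deriv F (G y) := by
            field_simp [(hdp (G y)).ne']
        _ ≤ _ := by
            apply mul_le_mul_of_nonneg_left h2
            exact div_nonneg (hnn _) (hdp _).le
    calc h (G x) ≤ exp (a * |G x - G y|) * h (G y) := h1
      _ ≤ exp (a * |G x - G y|) * (h (G y) / deriv F (G y) * (exp (M * |G x - G y|) * deriv F (G x))) := by gcongr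
      _ = (exp (a * |G x - G y|) * exp (M * |G x - G y|)) * (h (G y) / deriv F (G y)) * deriv F (G x) := by ring
      _ ≤ _ := by
        have := div_nonneg (hnn (G y)) (hdp (G y)).le
        have := (hdp (G x)).le
        gcongr
  refine ⟨fun y => ∑ k ∈ Finset.range w, q (y + k), ⟨?_, ?_, ?_, ?_⟩, ?_⟩
  · fun_prop
  · intro y
    have e1 : ∀ k : ℕ, q (y + 1 + k) = (fun k : ℕ => q (y + k)) (k + 1) := by
      intro k; simp only; push_cast; ring_nf
    simp only [e1]
    have e2 := Finset.sum_range_succ (fun k : ℕ => q (y + k)) w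
    rw [Finset.sum_range_succ'] at e2
    simp only [Nat.cast_zero, add_zero, hqw] at e2
    linarith
  · intro y
    exact Finset.sum_nonneg fun k _ => div_nonneg (hnn _) (hdp _).le
  · intro x y
    rw [Finset.mul_sum]
    apply Finset.sum_le_sum
    intro k _
    simpa using hqlog (x + k) (y + k)
  · intro f hf hfp
    have s1 : ∫ x in (0:ℝ)..1, f (F x) * h x = ∫ y in (F 0)..(F 1), f y * q y := by
      rw [← intervalIntegral.integral_comp_mul_deriv (g := fun y => f y * q y)
        (fun x _ => (hFd x).hasDerivAt) hF1.continuous.continuousOn (by fun_prop)]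
      congr 1
      ext x
      simp only [Function.comp, hq, hGF]
      field_simp [(hdp x).ne']
    have s2 := intervalIntegral.sum_integral_adjacent_intervals (μ := volume)
      (f := fun y => f y * q y) (a := fun k : ℕ => F 0 + k) (n := w)
      (fun k _ => (hf.mul hqc).intervalIntegrable _ _)
    have hF10 : F 1 = F 0 + w := by simpa using hFw 0
    rw [s1, hF10]
    simp only [Nat.cast_zero, add_zero] at s2
    rw [← s2]
    have s3 : ∀ k : ℕ, ∫ y in (F 0 + k)..(F 0 + (k + 1 : ℕ)), f y * q y
        = ∫ y in (F 0)..(F 0 + 1), f y * q (y + k) := by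
      intro k
      have : F 0 + ((k + 1 : ℕ) : ℝ) = (F 0 + 1) + k := by push_cast; ring
      rw [this, ← intervalIntegral.integral_comp_add_right]
      congr 1
      ext y
      have := hfp.nat_mul k y
      rw [mul_one] at this
      rw [this]
    simp only [s3]
    rw [← intervalIntegral.integral_finsetSum]
    · simp only [← Finset.mul_sum]
      have hper2 : Function.Periodic (fun y => f y * ∑ k ∈ Finset.range w, q (y + k)) 1 := by
        intro y
        have e1 : ∀ k : ℕ, q (y + 1 + k) = (fun k : ℕ => q (y + k)) (k + 1) := by
          intro k; simp only; push_cast; ring_nf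
        simp only [e1, hfp y]
        have e2 := Finset.sum_range_succ (fun k : ℕ => q (y + k)) w
        rw [Finset.sum_range_succ'] at e2
        simp only [Nat.cast_zero, add_zero, hqw] at e2
        congr 1
        linarith
      simpa using hper2.intervalIntegral_add_eq (F 0) 0
    · intro k _
      apply Continuous.intervalIntegrable
      fun_prop

theorem mix_cone_shift {a a' : ℝ} (ha' : 0 ≤ a') (haa : a' < a) {h : ℝ → ℝ} (hh : MixCone a' h) :
    MixCone a (fun x => h x - exp (-a') * (1 - a' / a) * ∫ x in (0:ℝ)..1, h x) := by
  obtain ⟨hc, hp, hn, hl⟩ := hh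
  have ha : 0 < a := by linarith
  set I := ∫ x in (0:ℝ)..1, h x with hI
  have hI0 : 0 ≤ I := intervalIntegral.integral_nonneg (by norm_num) (fun x _ => hn x)
  have hlow : ∀ y, exp (-a') * I ≤ h y := by
    intro y
    have e1 : I = ∫ x in y..(y + 1), h x := by
      simpa using hp.intervalIntegral_add_eq 0 y
    have e2 : I ≤ ∫ x in y..(y + 1), exp a' * h y := by
      rw [e1]
      apply intervalIntegral.integral_mono_on (by linarith) (hc.intervalIntegrable _ _)
        (continuous_const.intervalIntegrable _ _)
      intro x hx
      refine (hl x y).trans ?_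
      apply mul_le_mul_of_nonneg_right _ (hn y)
      apply exp_le_exp.2
      have : |x - y| ≤ 1 := by rw [abs_le]; constructor <;> linarith [hx.1, hx.2]
      nlinarith
    rw [intervalIntegral.integral_const, add_sub_cancel_left, one_smul] at e2
    calc exp (-a') * I ≤ exp (-a') * (exp a' * h y) := by gcongr
      _ = h y := by rw [← mul_assoc, ← exp_add]; simp
  have hr0 : 0 ≤ a' / a := by positivity
  have hr1 : a' / a < 1 := by rw [div_lt_one ha]; exact haa
  have hE := mul_nonneg (exp_pos (-a')).le hI0
  refine ⟨by fun_prop, fun x => by simp only [hp x], fun x => ?_, fun x y => ?_⟩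
  · have := hlow x
    nlinarith
  · have e1 := hl x y
    have e2 := hlow y
    set d := |x - y| with hd
    have hd0 : 0 ≤ d := abs_nonneg _
    -- convexity
    have e3 : exp (a' * d) - 1 ≤ a' / a * (exp (a * d) - 1) := by
      have := convexOn_exp.2 (Set.mem_univ (a * d)) (Set.mem_univ 0) hr0 (sub_nonneg.2 hr1.le) (by ring)
      simp only [smul_eq_mul, mul_zero, add_zero, exp_zero, mul_one] at this
      have h4 : a' / a * (a * d) = a' * d := by field_simp
      rw [h4] at this
      linarith
    have e4 : 1 ≤ exp (a * d) := one_le_exp (by positivity)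
    have e5 : (1 - a' / a) * (exp (a * d) - 1) ≤ exp (a * d) - exp (a' * d) := by linarith
    have e6 : 0 ≤ (1 - a' / a) * (exp (a * d) - 1) :=
      mul_nonneg (by linarith) (by linarith)
    have e7 : exp (-a') * I * ((1 - a' / a) * (exp (a * d) - 1))
        ≤ h y * (exp (a * d) - exp (a' * d)) :=
      mul_le_mul e2 e5 e6 (hn y)
    linarith

theorem mix_decay
    (F : ℝ → ℝ) (hF : ContDiff ℝ 2 F)
    (w : ℕ) (hFw : ∀ x : ℝ, F (x + 1) = F x + w)
    (lam : ℝ) (hlam : 1 < lam) (hexp : ∀ x : ℝ, lam ≤ deriv F x) :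
    ∃ a κ : ℝ, 0 < a ∧ 0 < κ ∧ κ ≤ 1 ∧ ∀ f : ℝ → ℝ, Continuous f → Function.Periodic f 1 →
      ∀ B, (∀ x, |f x| ≤ B) → ∀ n : ℕ, ∀ h k, MixCone a h → MixCone a k →
      ∀ I, ∫ x in (0:ℝ)..1, h x = I → ∫ x in (0:ℝ)..1, k x = I →
      |∫ x in (0:ℝ)..1, f (F^[n] x) * (h x - k x)| ≤ 2 * B * I * (1 - κ) ^ n := by
  obtain ⟨a, a', ha', haa, hL⟩ := mix_transfer F hF w hFw lam hlam hexp
  have ha : 0 < a := by linarith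
  have hr0 : 0 ≤ a' / a := by positivity
  have hr1 : a' / a < 1 := by rw [div_lt_one ha]; exact haa
  refine ⟨a, exp (-a') * (1 - a' / a), ha, mul_pos (exp_pos _) (by linarith), ?_, ?_⟩
  · have := exp_le_one_iff.2 (neg_nonpos.2 ha')
    nlinarith [exp_pos (-a')]
  set κ := exp (-a') * (1 - a' / a) with hκ
  intro f hf hfp B hB n
  have hB0 : 0 ≤ B := (abs_nonneg _).trans (hB 0)
  have hFc : Continuous F := hF.continuous
  have hpn : ∀ n : ℕ, Function.Periodic (fun x => f (F^[n] x)) 1 := by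
    have hit : ∀ n : ℕ, ∀ x, ∀ m : ℕ, ∃ m' : ℕ, F^[n] (x + m) = F^[n] x + m' := by
      have h0 : ∀ x, ∀ m : ℕ, ∃ m' : ℕ, F (x + m) = F x + m' := by
        intro x m
        induction m with
        | zero => exact ⟨0, by simp⟩
        | succ m ih =>
          obtain ⟨m', hm'⟩ := ih
          refine ⟨m' + w, ?_⟩
          push_cast
          rw [← add_assoc, hFw, hm']; ring
      intro n
      induction n with
      | zero => intro x m; exact ⟨m, rfl⟩
      | succ n ih =>
        intro x m
        obtain ⟨m', hm'⟩ := h0 x m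
        simp only [Function.iterate_succ, Function.comp]
        rw [hm']
        exact ih _ _
    intro n x
    obtain ⟨m', hm'⟩ := hit n x 1
    simp only
    rw [Nat.cast_one] at hm'
    rw [hm']
    simpa using hfp.nat_mul m' (F^[n] x)
  induction n with
  | zero =>
    rintro h k ⟨hc, -, hn, -⟩ ⟨kc, -, kn, -⟩ I hI kI
    simp only [Function.iterate_zero, id, pow_zero, mul_one]
    calc |∫ x in (0:ℝ)..1, f x * (h x - k x)| ≤ ∫ x in (0:ℝ)..1, |f x * (h x - k x)| :=
          intervalIntegral.abs_integral_le_integral_abs (by norm_num)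
      _ ≤ ∫ x in (0:ℝ)..1, B * (h x + k x) := by
          apply intervalIntegral.integral_mono_on (by norm_num)
            (Continuous.intervalIntegrable (by fun_prop) _ _)
            (Continuous.intervalIntegrable (by fun_prop) _ _)
          intro x _
          rw [abs_mul]
          apply mul_le_mul (hB x) _ (abs_nonneg _) hB0
          rw [abs_le]
          constructor <;> linarith [hn x, kn x]
      _ = 2 * B * I := by
          rw [intervalIntegral.integral_const_mul, intervalIntegral.integral_add
            (hc.intervalIntegrable _ _) (kc.intervalIntegrable _ _), hI, kI]
          ring
  | succ n ih =>
    intro h k hh hk I hI kI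
    obtain ⟨h', hh', Hh⟩ := hL h hh
    obtain ⟨k', hk', Hk⟩ := hL k hk
    have i1 : ∫ x in (0:ℝ)..1, h' x = I := by
      have := Hh (fun _ => 1) continuous_const (fun _ => rfl)
      simpa [hI] using this.symm
    have i2 : ∫ x in (0:ℝ)..1, k' x = I := by
      have := Hk (fun _ => 1) continuous_const (fun _ => rfl)
      simpa [kI] using this.symm
    have c1 := mix_cone_shift ha' haa hh'
    have c2 := mix_cone_shift ha' haa hk'
    rw [i1, ← hκ] at c1
    rw [i2, ← hκ] at c2
    have hfn : Continuous (fun x => f (F^[n] x)) := hf.comp (hFc.iterate n)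
    have j1 : ∫ x in (0:ℝ)..1, (h' x - κ * I) = (1 - κ) * I := by
      rw [intervalIntegral.integral_sub (hh'.1.intervalIntegrable _ _)
        (continuous_const.intervalIntegrable _ _), i1]
      simp; ring
    have j2 : ∫ x in (0:ℝ)..1, (k' x - κ * I) = (1 - κ) * I := by
      rw [intervalIntegral.integral_sub (hk'.1.intervalIntegrable _ _)
        (continuous_const.intervalIntegrable _ _), i2]
      simp; ring
    have := ih _ _ c1 c2 _ j1 j2
    have hfn1 : Continuous (fun x => f (F^[n] (F x))) := hfn.comp hFc
    have e1 : ∫ x in (0:ℝ)..1, f (F^[n+1] x) * (h x - k x)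
        = ∫ x in (0:ℝ)..1, f (F^[n] x) * ((h' x - κ * I) - (k' x - κ * I)) := by
      simp only [Function.iterate_succ, Function.comp, sub_sub_sub_cancel_right, mul_sub]
      have t1 : Continuous fun x => f (F^[n] (F x)) * h x := hfn1.mul hh.1
      have t2 : Continuous fun x => f (F^[n] (F x)) * k x := hfn1.mul hk.1
      have t3 : Continuous fun x => f (F^[n] x) * h' x := hfn.mul hh'.1
      have t4 : Continuous fun x => f (F^[n] x) * k' x := hfn.mul hk'.1
      rw [intervalIntegral.integral_sub (t1.intervalIntegrable _ _) (t2.intervalIntegrable _ _),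
        intervalIntegral.integral_sub (t3.intervalIntegrable _ _) (t4.intervalIntegrable _ _)]
      rw [Hh _ hfn (hpn n), Hk _ hfn (hpn n)]
    rw [e1]
    refine this.trans (le_of_eq ?_)
    rw [pow_succ]; ring

def mixLipAlg : Subalgebra ℝ C(UnitAddCircle, ℝ) where
  carrier := {f | ∃ K, LipschitzWith K f}
  mul_mem' := by
    rintro f g ⟨K, hK⟩ ⟨L, hL⟩
    refine ⟨K * ‖g‖₊ + ‖f‖₊ * L, LipschitzWith.of_dist_le_mul fun x y => ?_⟩
    have h1 := hK.dist_le_mul x y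
    have h2 := hL.dist_le_mul x y
    rw [Real.dist_eq] at *
    simp only [ContinuousMap.mul_apply, NNReal.coe_add, NNReal.coe_mul, coe_nnnorm]
    have g1 : |g x| ≤ ‖g‖ := g.norm_coe_le_norm x
    have f1 : |f y| ≤ ‖f‖ := f.norm_coe_le_norm y
    have : f x * g x - f y * g y = (f x - f y) * g x + f y * (g x - g y) := by ring
    rw [this]
    refine (abs_add_le _ _).trans ?_
    rw [abs_mul, abs_mul, add_mul]
    have := dist_nonneg (x := x) (y := y)
    calc _ ≤ (K * dist x y) * ‖g‖ + ‖f‖ * (L * dist x y) := by gcongr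
      _ = _ := by ring
  add_mem' := by
    rintro f g ⟨K, hK⟩ ⟨L, hL⟩
    exact ⟨K + L, hK.add hL⟩
  algebraMap_mem' := fun r => ⟨0, LipschitzWith.const r⟩

theorem mixLipAlg_dense : Dense (mixLipAlg : Set C(UnitAddCircle, ℝ)) := by
  have h : mixLipAlg.topologicalClosure = ⊤ := by
    apply ContinuousMap.subalgebra_topologicalClosure_eq_top_of_separatesPoints
    intro x y hxy
    refine ⟨_, ⟨⟨fun z => dist z y, by fun_prop⟩, ⟨1, LipschitzWith.dist_left y⟩, rfl⟩, ?_⟩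
    simpa using hxy
  intro x
  have : x ∈ mixLipAlg.topologicalClosure := by rw [h]; trivial
  exact this

theorem mix_lip_cone {a : ℝ} (ha : 0 < a) {h : C(UnitAddCircle, ℝ)} (hh : h ∈ mixLipAlg) :
    ∃ M₀ : ℝ, ∀ M, M₀ ≤ M → MixCone a (fun x : ℝ => h (x : UnitAddCircle) + M) := by
  obtain ⟨K, hK⟩ := hh
  refine ⟨K / a + ‖h‖, fun M hM => ?_⟩
  have hlow : ∀ z, K / a ≤ h z + M := by
    intro z
    have := (abs_le.1 (h.norm_coe_le_norm z)).1
    linarith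
  have hK0 : 0 ≤ (K : ℝ) / a := by positivity
  refine ⟨?_, ?_, fun x => hK0.trans (hlow _), fun x y => ?_⟩
  · exact (h.continuous.comp (AddCircle.continuous_mk' 1)).add continuous_const
  · intro x
    simp only
    rw [AddCircle.coe_add, AddCircle.coe_period, add_zero]
  · have h1 := hK.dist_le_mul (x : UnitAddCircle) (y : UnitAddCircle)
    have h2 : dist (x : UnitAddCircle) (y : UnitAddCircle) ≤ |x - y| := by
      rw [dist_eq_norm, ← AddCircle.coe_sub]
      rw [UnitAddCircle.norm_eq]
      simpa using round_le (x - y) 0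
    rw [Real.dist_eq] at h1
    have h3 := hlow y
    rw [div_le_iff₀ ha] at h3
    have h4 := add_one_le_exp (a * |x - y|)
    have h5 := hK0.trans (hlow y)
    have h6 := le_abs_self (h (x : UnitAddCircle) - h (y : UnitAddCircle))
    have h7 : (K : ℝ) * dist (x : UnitAddCircle) (y : UnitAddCircle) ≤ K * |x - y| := by gcongr
    have h8 : (K : ℝ) * |x - y| ≤ (h y + M) * a * |x - y| := by gcongr
    calc h (x : UnitAddCircle) + M ≤ (a * |x - y| + 1) * (h y + M) := by linarith
      _ ≤ _ := by gcongr

theorem mix_L2 (T : UnitAddCircle → UnitAddCircle) (μ : Measure UnitAddCircle)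
    [IsProbabilityMeasure μ] (hmp : MeasurePreserving T μ μ)
    (H : ∀ f g : C(UnitAddCircle, ℝ), g ∈ mixLipAlg →
      Filter.Tendsto (fun n : ℕ => ∫ x, f (T^[n] x) * g x ∂μ)
        Filter.atTop (nhds ((∫ x, f x ∂μ) * ∫ x, g x ∂μ))) :
    ∀ f g : UnitAddCircle → ℝ, MemLp f 2 μ → MemLp g 2 μ →
      Filter.Tendsto (fun n : ℕ => ∫ x, f (T^[n] x) * g x ∂μ)
        Filter.atTop (nhds ((∫ x, f x ∂μ) * ∫ x, g x ∂μ)) := by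
  have hmi : ∀ n, MeasurePreserving (T^[n]) μ μ := fun n => hmp.iterate n
  set U : ℕ → Lp ℝ 2 μ →ₗᵢ[ℝ] Lp ℝ 2 μ := fun n =>
    Lp.compMeasurePreservingₗᵢ ℝ (T^[n]) (hmi n) with hU
  have h1m : MemLp (fun _ : UnitAddCircle => (1:ℝ)) 2 μ := memLp_const 1
  set one : Lp ℝ 2 μ := h1m.toLp _ with hone
  -- identification of inner products
  have id1 : ∀ (f g : UnitAddCircle → ℝ) (hf : MemLp f 2 μ) (hg : MemLp g 2 μ) (n : ℕ),
      inner ℝ (U n (hf.toLp f)) (hg.toLp g) = ∫ x, f (T^[n] x) * g x ∂μ := by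
    intro f g hf hg n
    rw [L2.inner_def]
    apply integral_congr_ae
    have e1 : U n (hf.toLp f) = (hf.comp_measurePreserving (hmi n)).toLp _ :=
      Lp.toLp_compMeasurePreserving hf (hmi n)
    rw [e1]
    filter_upwards [(hf.comp_measurePreserving (hmi n)).coeFn_toLp, hg.coeFn_toLp] with x h1 h2
    rw [h1, h2]
    simp [mul_comm]
  have id2 : ∀ (f : UnitAddCircle → ℝ) (hf : MemLp f 2 μ),
      inner ℝ one (hf.toLp f) = ∫ x, f x ∂μ := by
    intro f hf
    rw [L2.inner_def]
    apply integral_congr_ae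
    filter_upwards [hf.coeFn_toLp, h1m.coeFn_toLp] with x h1 h2
    rw [h1, hone, h2]
    simp
  have lipf : ∀ (g : Lp ℝ 2 μ), IsClosed {f : Lp ℝ 2 μ | Filter.Tendsto
      (fun n => inner ℝ (U n f) g) Filter.atTop (nhds (inner ℝ one f * inner ℝ one g))} := by
    intro g
    refine Equicontinuous.isClosed_setOfPred_tendsto (F := fun n f => inner ℝ (U n f) g) ?_
      (by fun_prop)
    apply UniformEquicontinuous.equicontinuous
    apply LipschitzWith.uniformEquicontinuous _ ‖g‖₊
    intro n
    apply LipschitzWith.of_dist_le_mul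
    intro x y
    rw [Real.dist_eq, ← inner_sub_left, ← map_sub, dist_eq_norm]
    refine (abs_real_inner_le_norm _ _).trans ?_
    rw [(U n).norm_map, mul_comm, coe_nnnorm]
  have lipg : ∀ (f : Lp ℝ 2 μ), IsClosed {g : Lp ℝ 2 μ | Filter.Tendsto
      (fun n => inner ℝ (U n f) g) Filter.atTop (nhds (inner ℝ one f * inner ℝ one g))} := by
    intro f
    refine Equicontinuous.isClosed_setOfPred_tendsto (F := fun n g => inner ℝ (U n f) g) ?_
      (by fun_prop)
    apply UniformEquicontinuous.equicontinuous
    apply LipschitzWith.uniformEquicontinuous _ ‖f‖₊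
    intro n
    apply LipschitzWith.of_dist_le_mul
    intro x y
    rw [Real.dist_eq, ← inner_sub_right, dist_eq_norm]
    refine (abs_real_inner_le_norm _ _).trans ?_
    rw [(U n).norm_map, coe_nnnorm]
  have hd : DenseRange (ContinuousMap.toLp 2 μ ℝ : C(UnitAddCircle, ℝ) →L[ℝ] Lp ℝ 2 μ) :=
    ContinuousMap.toLp_denseRange ℝ μ ℝ (by norm_num)
  have hcm : ∀ f : C(UnitAddCircle, ℝ), ∃ hf : MemLp f 2 μ,
      ContinuousMap.toLp 2 μ ℝ f = hf.toLp f := by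
    intro f
    have h0 := ContinuousMap.coeFn_toLp (p := 2) (𝕜 := ℝ) μ f
    have hf : MemLp f 2 μ := (memLp_congr_ae h0).1 (Lp.memLp _)
    exact ⟨hf, Lp.ext (h0.trans hf.coeFn_toLp.symm)⟩
  have hd2 := hd.dense_image (ContinuousMap.toLp 2 μ ℝ).continuous mixLipAlg_dense
  have all : ∀ f g : Lp ℝ 2 μ, Filter.Tendsto
      (fun n => inner ℝ (U n f) g) Filter.atTop (nhds (inner ℝ one f * inner ℝ one g)) := by
    have s1 : ∀ f : C(UnitAddCircle, ℝ), ∀ g : Lp ℝ 2 μ, Filter.Tendsto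
        (fun n => inner ℝ (U n (ContinuousMap.toLp 2 μ ℝ f)) g) Filter.atTop
        (nhds (inner ℝ one (ContinuousMap.toLp 2 μ ℝ f) * inner ℝ one g)) := by
      intro f g
      have := closure_minimal
        (s := Set.image (ContinuousMap.toLp 2 μ ℝ) (mixLipAlg : Set C(UnitAddCircle, ℝ))) (by
          rintro _ ⟨g, hg, rfl⟩
          obtain ⟨hf', ef⟩ := hcm f
          obtain ⟨hg', eg⟩ := hcm g
          rw [Set.mem_ofPred_eq, ef, eg]
          simp only [id1, id2]
          exact H f g hg) (lipg (ContinuousMap.toLp 2 μ ℝ f))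
      exact this (hd2 g)
    intro f g
    have := closure_minimal
      (s := Set.range (ContinuousMap.toLp 2 μ ℝ)) (by
        rintro _ ⟨f, rfl⟩
        exact s1 f g) (lipf g)
    exact this (hd f)
  intro f g hf hg
  have := all (hf.toLp f) (hg.toLp g)
  simpa only [id1, id2] using this

theorem acim_mixing
    (F : ℝ → ℝ) (hF : ContDiff ℝ 2 F)
    (w : ℕ) (hw : 0 < w) (hFw : ∀ x : ℝ, F (x + 1) = F x + w)
    (T : UnitAddCircle → UnitAddCircle) (hT : ∀ x : ℝ, T ↑x = (↑(F x) : UnitAddCircle))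
    (lam : ℝ) (hlam : 1 < lam) (hexp : ∀ x : ℝ, lam ≤ deriv F x)
    (nT'' : ℝ) (hnT'' : nT'' = ⨆ x : ℝ, |deriv (deriv F) x|)
    (Omega : ℝ) (hOmega : Omega = nT'' / (lam * (lam - 1)))
    (φ : UnitAddCircle → ℝ) (hφlip : LipschitzWith ((1 + Omega) ^ 2).toNNReal φ)
    (hφpos : ∀ x, 0 ≤ φ x)
    (μ : Measure UnitAddCircle)
    (hμ : μ = volume.withDensity (fun x => ENNReal.ofReal (φ x)))
    (hprob : IsProbabilityMeasure μ)
    (hinv : ∀ A : Set UnitAddCircle, MeasurableSet A → μ (T ⁻¹' A) = μ A) :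
    ∀ f g : UnitAddCircle → ℝ, MemLp f 2 μ → MemLp g 2 μ →
      Filter.Tendsto (fun n : ℕ => ∫ x, f (T^[n] x) * g x ∂μ)
        Filter.atTop (nhds ((∫ x, f x ∂μ) * ∫ x, g x ∂μ)) := by
  have hTc : Continuous T := by
    rw [(QuotientAddGroup.isQuotientMap_mk (AddSubgroup.zmultiples (1:ℝ))).continuous_iff]
    have : T ∘ (QuotientAddGroup.mk : ℝ → ℝ ⧸ AddSubgroup.zmultiples (1:ℝ))
        = fun x => ((F x : ℝ) : UnitAddCircle) := funext hT
    rw [this]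
    exact (AddCircle.continuous_mk' 1).comp hF.continuous
  have hTn : ∀ (n : ℕ) (x : ℝ), T^[n] (x : UnitAddCircle) = ((F^[n] x : ℝ) : UnitAddCircle) := by
    intro n
    induction n with
    | zero => intro x; rfl
    | succ n ih =>
      intro x
      simp only [Function.iterate_succ, Function.comp, hT, ih]
  have hmp : MeasurePreserving T μ μ := by
    refine ⟨hTc.measurable, ?_⟩
    ext A hA
    rw [Measure.map_apply hTc.measurable hA, hinv A hA]
  apply mix_L2 T μ hmp
  intro f g hg
  obtain ⟨a, κ, ha, hκ, hκ1, hdec⟩ := mix_decay F hF w hFw lam hlam hexp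
  have hmeasInt : ∀ u : UnitAddCircle → ℝ, ∫ x, u x ∂μ = ∫ x, φ x * u x := by
    intro u
    have hm : Measurable fun x => ENNReal.ofReal (φ x) :=
      ENNReal.measurable_ofReal.comp hφlip.continuous.measurable
    rw [hμ, integral_withDensity_eq_integral_toReal_smul hm (by simp)]
    simp only [ENNReal.toReal_ofReal (hφpos _), smul_eq_mul]
  have hmeasIntI : ∀ u : UnitAddCircle → ℝ, ∫ x, u x ∂μ = ∫ x in (0:ℝ)..1, φ x * u x := by
    intro u
    rw [hmeasInt, ← UnitAddCircle.intervalIntegral_preimage 0 (fun x => φ x * u x), zero_add]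
  set φc : C(UnitAddCircle, ℝ) := ⟨φ, hφlip.continuous⟩ with hφc
  have hφA : φc ∈ mixLipAlg := ⟨_, hφlip⟩
  set c := ∫ x, g x ∂μ with hc
  have hA1 : φc * g ∈ mixLipAlg := mixLipAlg.mul_mem hφA hg
  have hA2 : c • φc ∈ mixLipAlg := mixLipAlg.smul_mem hφA c
  obtain ⟨M1, hM1⟩ := mix_lip_cone ha hA1
  obtain ⟨M2, hM2⟩ := mix_lip_cone ha hA2
  have C1 := hM1 (max M1 M2) (le_max_left _ _)
  have C2 := hM2 (max M1 M2) (le_max_right _ _)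
  set M := max M1 M2
  have cmk : Continuous (fun x : ℝ => (x : UnitAddCircle)) := AddCircle.continuous_mk' 1
  have cφ : Continuous (fun x : ℝ => φ (x : UnitAddCircle)) := hφlip.continuous.comp cmk
  have cg : Continuous (fun x : ℝ => g (x : UnitAddCircle)) := g.continuous.comp cmk
  have hφ1 : ∫ x in (0:ℝ)..1, φ x = 1 := by
    have := hmeasIntI (fun _ => 1)
    simpa using this.symm
  have I1 : ∫ x in (0:ℝ)..1, ((φc * g) (x : UnitAddCircle) + M) = c + M := by
    have t : Continuous fun x : ℝ => (φc * g) (x : UnitAddCircle) :=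
      (φc * g).continuous.comp cmk
    rw [intervalIntegral.integral_add (t.intervalIntegrable _ _)
      (continuous_const.intervalIntegrable _ _), hc, hmeasIntI]
    simp [hφc]
  have I2 : ∫ x in (0:ℝ)..1, ((c • φc) (x : UnitAddCircle) + M) = c + M := by
    have t : Continuous fun x : ℝ => (c • φc) (x : UnitAddCircle) :=
      (c • φc).continuous.comp cmk
    rw [intervalIntegral.integral_add (t.intervalIntegrable _ _)
      (continuous_const.intervalIntegrable _ _)]
    simp [hφc, hφ1]
  have hfp : Function.Periodic (fun x : ℝ => f (x : UnitAddCircle)) 1 := by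
    intro x
    simp only
    rw [AddCircle.coe_add, AddCircle.coe_period, add_zero]
  have key : ∀ n : ℕ, |(∫ x, f (T^[n] x) * g x ∂μ) - (∫ x, f x ∂μ) * c|
      ≤ 2 * ‖f‖ * (c + M) * (1 - κ) ^ n := by
    intro n
    refine le_trans (le_of_eq ?_) (hdec _ (f.continuous.comp cmk) hfp ‖f‖
      (fun x => f.norm_coe_le_norm _) n _ _ C1 C2 _ I1 I2)
    have e1 : ∫ x, f x ∂μ = ∫ x, f (T^[n] x) ∂μ := by
      have hm := hmp.iterate n
      conv_lhs => rw [← hm.map_eq]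
      exact integral_map hm.measurable.aemeasurable (f.continuous.aestronglyMeasurable)
    have cfn : Continuous (fun x : ℝ => f ((F^[n] x : ℝ) : UnitAddCircle)) :=
      f.continuous.comp (cmk.comp (hF.continuous.iterate n))
    rw [e1, hmeasIntI, hmeasIntI]
    simp only [hTn]
    rw [mul_comm _ c, ← intervalIntegral.integral_const_mul, ← intervalIntegral.integral_sub]
    · congr 2
      ext x
      simp only [hφc, ContinuousMap.mul_apply, ContinuousMap.smul_apply, ContinuousMap.coe_mk,
        smul_eq_mul, Function.comp]
      ring
    · exact Continuous.intervalIntegrable (cφ.mul (cfn.mul cg)) _ _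
    · exact Continuous.intervalIntegrable (continuous_const.mul (cφ.mul cfn)) _ _
  rw [tendsto_iff_dist_tendsto_zero]
  have hlim : Filter.Tendsto (fun n : ℕ => 2 * ‖f‖ * (c + M) * (1 - κ) ^ n) Filter.atTop
      (nhds 0) := by
    have := (tendsto_pow_atTop_nhds_zero_of_lt_one (r := 1 - κ) (by linarith)
      (by linarith)).const_mul (2 * ‖f‖ * (c + M))
    simpa using this
  refine squeeze_zero (fun _ => dist_nonneg) (fun n => ?_) hlim
  rw [Real.dist_eq]
  exact key n
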